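/- arXiv:2412.12366 — 3 statements merged into one kernel-verified Lean document; each statement's English description precedes it below -/
import Mathlib

section
/- Let A be a unital, simple C*-algebra in which the invertible elements are dense (stable rank one), and let a be a positive element of A. Then the following are equivalent: (i) there exists ε > 0 such that a ∼ (a − ε)₊; (ii) 0 is an isolated point of the spectrum of a, or 0 does not belong to the spectrum of a; (iii) there exists a projection p in A such that a ∼ p. -/
/-- Cuntz subequivalence of elements of a C*-algebra. -/
def CuntzBelow {A : Type*} [CStarAlgebra A] (x y : A) : Prop :=
  ∃ d : ℕ → A, Filter.Tendsto (fun n => d n * y * star (d n)) Filter.atTop (nhds x)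

/-- Cuntz equivalence of elements of a C*-algebra. -/
def CuntzEquiv {A : Type*} [CStarAlgebra A] (x y : A) : Prop :=
  CuntzBelow x y ∧ CuntzBelow y x

/-- If invertibles are dense, left invertible elements are invertible. -/
lemma aux_unit {A : Type*} [CStarAlgebra A] (hsr1 : Dense {x : A | IsUnit x})
    (w z : A) (h : z * w = 1) : IsUnit w := by
  have ho : IsOpen {x : A | IsUnit (z * x)} :=
    Units.isOpen.preimage (continuous_const.mul continuous_id)
  have hne : {x : A | IsUnit (z * x)}.Nonempty := ⟨w, by simp [h]⟩
  obtain ⟨x, hx, hxu⟩ := hsr1.inter_open_nonempty _ ho hne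
  have hxu' : IsUnit x := hxu
  have hz : IsUnit z := by
    have h1 : IsUnit (z * x) := hx
    obtain ⟨u, rfl⟩ := hxu'
    simpa using h1
  obtain ⟨u, rfl⟩ := hz
  have : w = ↑u⁻¹ := by
    rw [← Units.inv_mul_cancel_left u w, h, mul_one]
  rw [this]
  exact Units.isUnit _

lemma aux_12 {A : Type*} [CStarAlgebra A] [PartialOrder A] [StarOrderedRing A]
    (hsr1 : Dense {x : A | IsUnit x})
    (a : A) (ha : 0 ≤ a) (ε : ℝ) (hε : 0 < ε)
    (h : CuntzBelow a (cfc (fun s : ℝ => max (s - ε) 0) a)) :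
    ∀ s ∈ spectrum ℝ a, s ≠ 0 → ε ≤ |s| := by
  intro t ht ht0
  by_contra hlt
  push Not at hlt
  have hsa : IsSelfAdjoint a := IsSelfAdjoint.of_nonneg ha
  have hpos : ∀ s ∈ spectrum ℝ a, 0 ≤ s := fun s hs => spectrum_nonneg_of_nonneg ha hs
  have htp : 0 < t := lt_of_le_of_ne (hpos t ht) (Ne.symm ht0)
  rw [abs_of_pos htp] at hlt
  obtain ⟨d, hd⟩ := h
  set b := cfc (fun s : ℝ => max (s - ε) 0) a with hb
  set r := cfc (fun s : ℝ => √(max (s - ε) 0)) a with hr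
  set q := cfc (fun s : ℝ => max (t / 2 - s) 0) a with hq
  set f := cfc (fun s : ℝ => max ((s - t / 2) * (ε - s)) 0) a with hf
  have hrr : r * r = b := by
    rw [hr, hb, ← cfc_mul _ _ a]
    congr 1
    ext s
    exact Real.mul_self_sqrt (le_max_right _ _)
  have hrq : r * q = 0 := by
    rw [hr, hq, ← cfc_mul _ _ a]
    rw [← cfc_zero ℝ a]
    apply cfc_congr
    intro s hs
    rcases le_total s ε with h1 | h1
    · simp [max_eq_right (sub_nonpos.2 h1)]
    · have : max (t / 2 - s) 0 = 0 := max_eq_right (by linarith)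
      simp [this]
  have hfr : f * r = 0 := by
    rw [hr, hf, ← cfc_mul _ _ a]
    rw [← cfc_zero ℝ a]
    apply cfc_congr
    intro s hs
    rcases le_total s ε with h1 | h1
    · simp [max_eq_right (sub_nonpos.2 h1)]
    · have : max ((s - t / 2) * (ε - s)) 0 = 0 := max_eq_right (by nlinarith)
      simp [this]
  have hfq : f * q = 0 := by
    rw [hq, hf, ← cfc_mul _ _ a]
    rw [← cfc_zero ℝ a]
    apply cfc_congr
    intro s hs
    rcases le_total s (t / 2) with h1 | h1
    · have : max ((s - t / 2) * (ε - s)) 0 = 0 := max_eq_right (by nlinarith)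
      simp [this]
    · have : max (t / 2 - s) 0 = 0 := max_eq_right (by linarith)
      simp [this]
  have hrs : star r = r := IsSelfAdjoint.star_eq (cfc_predicate _ a)
  have hqs : star q = q := IsSelfAdjoint.star_eq (cfc_predicate _ a)
  have hqr : q * r = 0 := by
    have := congrArg star hrq
    simpa [hrs, hqs] using this
  have hu : IsUnit (a + q * q) := by
    have : a + q * q = cfc (fun s : ℝ => s + max (t / 2 - s) 0 * max (t / 2 - s) 0) a := by
      rw [cfc_add (a := a) (fun s : ℝ => s) _, cfc_mul _ _ a, cfc_id' ℝ a]
    rw [this, isUnit_cfc_iff _ a]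
    intro s hs
    have h0 := hpos s hs
    rcases h0.eq_or_lt with h1 | h1
    · subst h1
      have : max (t / 2 - 0) 0 = t / 2 := by rw [sub_zero]; exact max_eq_left (by linarith)
      rw [this]; positivity
    · positivity
  have hlim : Filter.Tendsto (fun n => d n * b * star (d n) + q * q) Filter.atTop
      (nhds (a + q * q)) := hd.add_const _
  obtain ⟨n, hn⟩ := (hlim.eventually (Units.isOpen.mem_nhds hu)).exists
  have hn' : IsUnit (d n * b * star (d n) + q * q) := hn
  have hww : (d n * r + q) * (r * star (d n) + q) = d n * b * star (d n) + q * q := by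
    calc _ = d n * (r * r) * star (d n) + d n * (r * q) + (q * r) * star (d n) + q * q := by
          noncomm_ring
      _ = _ := by rw [hrr, hrq, hqr]; simp
  have hw : IsUnit (r * star (d n) + q) := by
    obtain ⟨u, hu'⟩ := hn'
    refine aux_unit hsr1 _ (↑u⁻¹ * (d n * r + q)) ?_
    rw [mul_assoc, hww, ← hu', Units.inv_mul]
  have hfw : f * (r * star (d n) + q) = 0 := by
    rw [mul_add, ← mul_assoc, hfr, hfq]; simp
  have hf0 : f = 0 := (hw.mul_left_eq_zero).1 hfw
  have hmem : max ((t - t / 2) * (ε - t)) 0 ∈ spectrum ℝ f := by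
    rw [hf, cfc_map_spectrum _ a]
    exact ⟨t, ht, rfl⟩
  have hpos' : 0 < (t - t / 2) * (ε - t) := mul_pos (by linarith) (by linarith)
  have : Nontrivial A := by
    by_contra hcon
    rw [not_nontrivial_iff_subsingleton] at hcon
    simp [spectrum.of_subsingleton] at ht
  rw [hf0, spectrum.zero_eq, max_eq_left hpos'.le] at hmem
  exact hpos'.ne' hmem

lemma aux_23 {A : Type*} [CStarAlgebra A] [PartialOrder A] [StarOrderedRing A]
    (a : A) (ha : 0 ≤ a) (ε : ℝ) (hε : 0 < ε)
    (h : ∀ s ∈ spectrum ℝ a, s ≠ 0 → ε ≤ |s|) :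
    ∃ p : A, IsSelfAdjoint p ∧ IsIdempotentElem p ∧ CuntzEquiv a p := by
  have hsa : IsSelfAdjoint a := IsSelfAdjoint.of_nonneg ha
  have hpos : ∀ s ∈ spectrum ℝ a, 0 ≤ s := fun s hs => spectrum_nonneg_of_nonneg ha hs
  have hcase : ∀ s ∈ spectrum ℝ a, s = 0 ∨ ε ≤ s := by
    intro s hs
    by_cases h0 : s = 0
    · exact Or.inl h0
    · right; simpa [abs_of_nonneg (hpos s hs)] using h s hs h0
  have hmx : ∀ s : ℝ, max s ε ≠ 0 := fun s => (lt_max_of_lt_right hε).ne'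
  have hm1 : ∀ s : ℝ, ε ≤ s → min (s / ε) 1 = 1 := fun s hs =>
    min_eq_right ((one_le_div hε).2 hs)
  have hc : Continuous (fun s : ℝ => √(1 / max s ε)) := by
    apply Real.continuous_sqrt.comp
    exact continuous_const.div (by fun_prop) hmx
  refine ⟨cfc (fun s : ℝ => min (s / ε) 1) a, cfc_predicate _ a, ?_, ⟨fun _ => cfc (fun s : ℝ => √s) a, ?_⟩,
    ⟨fun _ => cfc (fun s : ℝ => √(1 / max s ε)) a, ?_⟩⟩
  · unfold IsIdempotentElem
    rw [← cfc_mul _ _ a]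
    apply cfc_congr
    intro s hs
    rcases hcase s hs with h0 | h0
    · simp [h0]
    · simp [hm1 s h0]
  · beta_reduce
    rw [IsSelfAdjoint.star_eq (cfc_predicate (fun s : ℝ => √s) a), ← cfc_mul _ _ a, ← cfc_mul _ _ a]
    have : cfc (fun s : ℝ => √s * min (s / ε) 1 * √s) a = a := by
      conv_rhs => rw [← cfc_id' ℝ a]
      apply cfc_congr
      intro s hs
      rcases hcase s hs with h0 | h0
      · simp [h0]
      · simp [hm1 s h0, Real.mul_self_sqrt (hpos s hs)]
    rw [this]
    exact tendsto_const_nhds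
  · beta_reduce
    rw [IsSelfAdjoint.star_eq (cfc_predicate (fun s : ℝ => √(1 / max s ε)) a)]
    have : cfc (fun s : ℝ => √(1 / max s ε)) a * a * cfc (fun s : ℝ => √(1 / max s ε)) a
        = cfc (fun s : ℝ => min (s / ε) 1) a := by
      conv_lhs => enter [1, 2]; rw [← cfc_id' ℝ a]
      rw [← cfc_mul _ _ a hc.continuousOn, ← cfc_mul _ _ a (hc.fun_mul continuous_id').continuousOn hc.continuousOn]
      apply cfc_congr
      intro s hs
      rcases hcase s hs with h0 | h0
      · simp [h0]
      · have hs0 : 0 < s := lt_of_lt_of_le hε h0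
        have : √(1 / s) * √(1 / s) = 1 / s := Real.mul_self_sqrt (by positivity)
        simp only [hm1 s h0, max_eq_left h0]
        rw [mul_right_comm, this]
        field_simp
    rw [this]
    exact tendsto_const_nhds

lemma aux_ba {A : Type*} [CStarAlgebra A] [PartialOrder A] [StarOrderedRing A]
    (a : A) (ha : 0 ≤ a) (ε : ℝ) (hε : 0 < ε) :
    CuntzBelow (cfc (fun s : ℝ => max (s - ε) 0) a) a := by
  have hsa : IsSelfAdjoint a := IsSelfAdjoint.of_nonneg ha
  have hmx : ∀ s : ℝ, max s ε ≠ 0 := fun s => (lt_max_of_lt_right hε).ne'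
  have hc : Continuous (fun s : ℝ => √(max (s - ε) 0 / max s ε)) := by
    apply Real.continuous_sqrt.comp
    exact Continuous.div (by fun_prop) (by fun_prop) hmx
  refine ⟨fun _ => cfc (fun s : ℝ => √(max (s - ε) 0 / max s ε)) a, ?_⟩
  beta_reduce
  rw [IsSelfAdjoint.star_eq (cfc_predicate (fun s : ℝ => √(max (s - ε) 0 / max s ε)) a)]
  have : cfc (fun s : ℝ => √(max (s - ε) 0 / max s ε)) a * a *
      cfc (fun s : ℝ => √(max (s - ε) 0 / max s ε)) a = cfc (fun s : ℝ => max (s - ε) 0) a := by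
    conv_lhs => enter [1, 2]; rw [← cfc_id' ℝ a]
    rw [← cfc_mul _ _ a hc.continuousOn, ← cfc_mul _ _ a (hc.fun_mul continuous_id').continuousOn hc.continuousOn]
    apply cfc_congr
    intro s hs
    simp only
    rw [mul_right_comm, Real.mul_self_sqrt (div_nonneg (le_max_right _ _) (le_max_of_le_right hε.le))]
    rcases le_total s ε with h0 | h0
    · simp [max_eq_right (sub_nonpos.2 h0)]
    · have hs0 : 0 < s := lt_of_lt_of_le hε h0
      simp only [max_eq_left h0]
      field_simp
  rw [this]
  exact tendsto_const_nhds

/-- The cut-downs are norm close. -/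
lemma aux_close {A : Type*} [CStarAlgebra A] [PartialOrder A] [StarOrderedRing A]
    (a : A) (ha : 0 ≤ a) (ε : ℝ) (hε : 0 < ε) :
    ‖cfc (fun s : ℝ => max (s - ε) 0) a - a‖ ≤ ε := by
  have hsa : IsSelfAdjoint a := IsSelfAdjoint.of_nonneg ha
  have hpos : ∀ s ∈ spectrum ℝ a, 0 ≤ s := fun s hs => spectrum_nonneg_of_nonneg ha hs
  have : cfc (fun s : ℝ => max (s - ε) 0) a - a = cfc (fun s : ℝ => max (s - ε) 0 - s) a := by
    rw [cfc_sub (a := a) (fun s : ℝ => max (s - ε) 0) (fun s => s), cfc_id' ℝ a]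
  rw [this]
  apply norm_cfc_le hε.le
  intro s hs
  have := hpos s hs
  rw [Real.norm_eq_abs, abs_le]
  constructor
  · linarith [le_max_left (s - ε) 0]
  · have : max (s - ε) 0 ≤ s := max_le (by linarith) this
    linarith

lemma aux_proj {A : Type*} [CStarAlgebra A] [PartialOrder A] [StarOrderedRing A]
    (p b d : A) (hb : 0 ≤ b) (hp : IsSelfAdjoint p) (hpp : IsIdempotentElem p)
    (h : IsUnit (p * (d * b * star d) * p + (1 - p))) :
    ∃ r : A, r * b * star r = p := by
  set z := p * (d * b * star d) * p + (1 - p) with hz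
  have hpp' : p * p = p := hpp
  have hzp : z * p = p * (d * b * star d) * p := by
    rw [hz, add_mul, sub_mul, one_mul, hpp', sub_self, add_zero, mul_assoc, hpp']
  have hpz : p * z = p * (d * b * star d) * p := by
    rw [hz, mul_add, mul_sub, mul_one, hpp', sub_self, add_zero]
    simp only [← mul_assoc]; rw [hpp']
  have h1 : 0 ≤ p * (d * b * star d) * p := by
    have := star_right_conjugate_nonneg (star_right_conjugate_nonneg hb d) p
    rwa [hp.star_eq] at this
  have h2 : 0 ≤ 1 - p := by
    have := star_mul_self_nonneg (1 - p)
    rwa [star_sub, star_one, hp.star_eq, (hpp.one_sub).eq] at this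
  have hz0 : 0 ≤ z := add_nonneg h1 h2
  have hzs : IsSelfAdjoint z := IsSelfAdjoint.of_nonneg hz0
  have hsp : ∀ s ∈ spectrum ℝ z, 0 < s := by
    intro s hs
    refine lt_of_le_of_ne (spectrum_nonneg_of_nonneg hz0 hs) ?_
    rintro rfl
    exact spectrum.zero_notMem ℝ h hs
  have hc : ContinuousOn (fun s : ℝ => √(s⁻¹)) (spectrum ℝ z) :=
    Real.continuous_sqrt.comp_continuousOn
      (continuousOn_id.inv₀ fun s hs => (hsp s hs).ne')
  set c := cfc (fun s : ℝ => √(s⁻¹)) z with hcdef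
  have hcs : star c = c := IsSelfAdjoint.star_eq (cfc_predicate _ z)
  have hczc : c * z * c = 1 := by
    conv_lhs => enter [1, 2]; rw [← cfc_id' ℝ z]
    rw [hcdef, ← cfc_mul _ _ z hc, ← cfc_mul _ _ z (hc.fun_mul (continuousOn_id' _)) hc, ← cfc_one ℝ z]
    apply cfc_congr
    intro s hs
    have := hsp s hs
    simp only
    rw [mul_right_comm, Real.mul_self_sqrt (by positivity)]
    simp [this.ne']
  have hcomm : Commute p c := by
    have : Commute z p := by rw [commute_iff_eq, hzp, hpz]
    exact (this.cfc_real _).symm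
  refine ⟨c * p * d, ?_⟩
  calc c * p * d * b * star (c * p * d) = c * (p * (d * b * star d) * p) * c := by
        rw [star_mul, star_mul, hcs, hp.star_eq]; noncomm_ring
    _ = c * z * (p * c) := by rw [← hzp]; noncomm_ring
    _ = p := by rw [hcomm.eq, ← mul_assoc, hczc, one_mul]

lemma aux_31 {A : Type*} [CStarAlgebra A] [PartialOrder A] [StarOrderedRing A]
    (a : A) (ha : 0 ≤ a) (p : A) (hp : IsSelfAdjoint p) (hpp : IsIdempotentElem p)
    (h : CuntzEquiv a p) :
    ∃ ε : ℝ, 0 < ε ∧ CuntzEquiv a (cfc (fun s : ℝ => max (s - ε) 0) a) := by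
  obtain ⟨⟨e, he⟩, d, hd⟩ := h
  have hpp' : p * p = p := hpp
  have hF : Continuous (fun x : A => p * x * p + (1 - p)) := by fun_prop
  have hlim := (hF.tendsto p).comp hd
  have hu : IsUnit (p * p * p + (1 - p)) := by simp [hpp']
  obtain ⟨n, hn⟩ := (hlim.eventually (Units.isOpen.mem_nhds hu)).exists
  have hG : Continuous (fun x : A => p * (d n * x * star (d n)) * p + (1 - p)) := by fun_prop
  have hopen : IsOpen {x : A | IsUnit (p * (d n * x * star (d n)) * p + (1 - p))} :=
    Units.isOpen.preimage hG
  obtain ⟨δ, hδ, hball⟩ := Metric.isOpen_iff.1 hopen a hn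
  refine ⟨δ / 2, by positivity, ?_, aux_ba a ha _ (by positivity)⟩
  have hmem := hball (show cfc (fun s : ℝ => max (s - δ / 2) 0) a ∈ Metric.ball a δ by
    rw [Metric.mem_ball, dist_eq_norm]
    exact lt_of_le_of_lt (aux_close a ha _ (by positivity)) (by linarith))
  obtain ⟨r, hr⟩ := aux_proj p _ (d n) (cfc_nonneg fun s _ => le_max_right _ _) hp hpp hmem
  refine ⟨fun m => e m * r, ?_⟩
  refine he.congr fun m => ?_
  conv_lhs => rw [← hr]
  rw [star_mul]; noncomm_ring

theorem stmt1 {A : Type*} [CStarAlgebra A] [PartialOrder A] [StarOrderedRing A]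
    (hsimple : ∀ I : TwoSidedIdeal A, IsClosed (I : Set A) → I = ⊥ ∨ I = ⊤)
    (hsr1 : Dense {x : A | IsUnit x})
    (a : A) (ha : 0 ≤ a) :
    List.TFAE
      [ ∃ ε : ℝ, 0 < ε ∧ CuntzEquiv a (cfc (fun s : ℝ => max (s - ε) 0) a),
        0 ∉ spectrum ℝ a ∨ ∃ ε : ℝ, 0 < ε ∧ ∀ s ∈ spectrum ℝ a, s ≠ 0 → ε ≤ |s|,
        ∃ p : A, IsSelfAdjoint p ∧ IsIdempotentElem p ∧ CuntzEquiv a p ] := by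
  tfae_have 1 → 2 := by
    rintro ⟨ε, hε, h, -⟩
    exact Or.inr ⟨ε, hε, aux_12 hsr1 a ha ε hε h⟩
  tfae_have 2 → 3 := by
    rintro (h | ⟨ε, hε, h⟩)
    · have ho : IsOpen (spectrum ℝ a)ᶜ := (spectrum.isClosed a).isOpen_compl
      obtain ⟨δ, hδ, hball⟩ := Metric.isOpen_iff.1 ho 0 h
      refine aux_23 a ha δ hδ fun s hs _ => ?_
      by_contra hlt
      push Not at hlt
      exact hball (by simpa using hlt) hs
    · exact aux_23 a ha ε hε h
  tfae_have 3 → 1 := by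
    rintro ⟨p, hp, hpp, h⟩
    exact aux_31 a ha p hp hpp h
  tfae_finish
end

section
/- Let A be a unital, simple C*-algebra in which the invertible elements are dense (stable rank one), and let a be a positive element of A that is Cuntz equivalent to some projection (i.e., a has compact Cuntz class). Let S_a = {b ∈ A : b positive, b ∼ a} with the subspace topology from A, and let P_a = {p ∈ A : p a projection, p ∼ a}. Then S_a deformation retracts onto P_a: there exists a continuous map F : [0,1] × S_a → S_a such that F(0, b) = b for all b ∈ S_a, F(1, b) ∈ P_a for all b ∈ S_a, and F(t, p) = p for every p ∈ P_a and every t ∈ [0,1]. -/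
/-- A projection in a C*-algebra: a self-adjoint idempotent. -/
def IsProjection {A : Type*} [CStarAlgebra A] (p : A) : Prop :=
  IsSelfAdjoint p ∧ IsIdempotentElem p

theorem CuntzBelow.exists_lt {A : Type*} [CStarAlgebra A] {x y : A} (h : CuntzBelow x y)
    {ε : ℝ} (hε : 0 < ε) : ∃ d : A, ‖d * y * star d - x‖ < ε := by
  obtain ⟨d, hd⟩ := h
  obtain ⟨n, hn⟩ := (Metric.tendsto_atTop.1 hd) ε hε
  exact ⟨d n, by simpa [dist_eq_norm] using hn n le_rfl⟩

theorem CuntzBelow.of_forall {A : Type*} [CStarAlgebra A] {x y : A}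
    (h : ∀ ε : ℝ, 0 < ε → ∃ d : A, ‖d * y * star d - x‖ < ε) : CuntzBelow x y := by
  choose d hd using fun n : ℕ => h (1 / ((n : ℝ) + 1)) (by positivity)
  refine ⟨d, ?_⟩
  rw [tendsto_iff_norm_sub_tendsto_zero]
  exact squeeze_zero (fun _ => norm_nonneg _) (fun n => (hd n).le)
    tendsto_one_div_add_atTop_nhds_zero_nat

theorem CuntzBelow.trans' {A : Type*} [CStarAlgebra A] {x y z : A}
    (h : CuntzBelow x y) (h' : CuntzBelow y z) : CuntzBelow x z := by
  apply CuntzBelow.of_forall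
  intro ε hε
  obtain ⟨d, hd⟩ := h.exists_lt (half_pos hε)
  have hpos : 0 < ‖d‖ ^ 2 + 1 := by positivity
  obtain ⟨e, he⟩ := h'.exists_lt (ε := ε / 2 / (‖d‖ ^ 2 + 1)) (by positivity)
  refine ⟨d * e, ?_⟩
  have e1 : d * e * z * star (d * e) - x
      = d * (e * z * star e - y) * star d + (d * y * star d - x) := by
    rw [star_mul]; noncomm_ring
  have e2 : ‖d * (e * z * star e - y) * star d‖ ≤ ε / 2 := by
    calc _ ≤ ‖d‖ * ‖e * z * star e - y‖ * ‖star d‖ := norm_mul₃_le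
      _ = ‖d‖ ^ 2 * ‖e * z * star e - y‖ := by rw [norm_star]; ring
      _ ≤ (‖d‖ ^ 2 + 1) * (ε / 2 / (‖d‖ ^ 2 + 1)) := by gcongr; linarith
      _ = ε / 2 := by field_simp
  rw [e1]
  linarith [norm_add_le (d * (e * z * star e - y) * star d) (d * y * star d - x)]

theorem CuntzBelow.of_eq {A : Type*} [CStarAlgebra A] {x y d : A}
    (h : d * y * star d = x) : CuntzBelow x y :=
  ⟨fun _ => d, by simp [h]⟩

theorem isUnit_of_right_inv {A : Type*} [CStarAlgebra A] (hsr1 : Dense {x : A | IsUnit x})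
    {w r : A} (h : w * r = 1) : IsUnit w := by
  have hpos : 0 < ‖w‖ + 1 := by positivity
  obtain ⟨x, hx, hxr⟩ := hsr1.exists_dist_lt r (ε := 1 / (‖w‖ + 1)) (by positivity)
  have hx' : IsUnit x := hx
  rw [dist_eq_norm] at hxr
  have h1 : ‖1 - w * x‖ < 1 := by
    have : 1 - w * x = w * (r - x) := by rw [mul_sub, h]
    rw [this]
    calc _ ≤ ‖w‖ * ‖r - x‖ := norm_mul_le _ _
      _ ≤ ‖w‖ * (1 / (‖w‖ + 1)) := by gcongr
      _ < 1 := by rw [mul_one_div, div_lt_one hpos]; linarith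
  have h2 : IsUnit (w * x) := by
    have := isUnit_one_sub_of_norm_lt_one h1
    simpa using this
  obtain ⟨u, rfl⟩ := hx'
  simpa using h2

theorem one_le_two_smul {A : Type*} [CStarAlgebra A] [PartialOrder A] [StarOrderedRing A]
    {u : A} (hu : IsSelfAdjoint u) (h : ‖u - 1‖ ≤ 1 / 2) : 1 ≤ (2 : ℝ) • u := by
  have hs : IsSelfAdjoint (1 - u) := (IsSelfAdjoint.one A).sub hu
  have h1 : 1 - u ≤ algebraMap ℝ A (1 / 2) :=
    hs.le_algebraMap_norm_self.trans (algebraMap_mono A (by rwa [norm_sub_rev]))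
  rw [Algebra.algebraMap_eq_smul_one] at h1
  have h2 := smul_le_smul_of_nonneg_left h1 (zero_le_two (α := ℝ))
  rw [smul_smul, smul_sub] at h2
  norm_num at h2
  have : (2 : ℝ) • (1 : A) = 1 + 1 := by rw [two_smul]
  rw [this] at h2
  exact le_of_add_le_add_left h2

theorem gap_step {A : Type*} [CStarAlgebra A] [PartialOrder A] [StarOrderedRing A]
    (hsr1 : Dense {x : A | IsUnit x}) {p d y : A} (hp : IsProjection p)
    (hy : y * p = y) (h : ‖d * (y * star y) * star d - p‖ ≤ 1 / 2) :
    y * star y ≤ (2 * ‖d‖ ^ 2) • (y * star y * (y * star y)) := by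
  have hps : star p = p := hp.1
  have hpp : p * p = p := hp.2
  have hpn : ‖p‖ ≤ 1 := by
    have := CStarRing.norm_star_mul_self (x := p)
    rw [hps, hpp] at this
    nlinarith [norm_nonneg p]
  have hy' : p * star y = star y := by
    have := congrArg star hy
    rwa [star_mul, hps] at this
  have hy1 : ∀ c, y * (p * c) = y * c := fun c => by rw [← mul_assoc, hy]
  have hpp1 : ∀ c, p * (p * c) = p * c := fun c => by rw [← mul_assoc, hpp]
  have hy2 : ∀ c, p * (star y * c) = star y * c := fun c => by rw [← mul_assoc, hy']
  set w : A := p * d * y + (1 - p) with hw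
  have hws : star w = star y * star d * p + (1 - p) := by
    simp [hw, star_mul, hps, mul_assoc]
  have hww : w * star w = 1 + p * (d * (y * star y) * star d - p) * p := by
    rw [hws, hw]
    simp only [mul_add, add_mul, mul_sub, sub_mul, mul_one, one_mul, mul_assoc, hy, hy', hpp,
      hy1, hy2, hpp1]
    abel
  have hnorm : ‖w * star w - 1‖ ≤ 1 / 2 := by
    rw [hww, add_sub_cancel_left]
    calc _ ≤ ‖p‖ * ‖d * (y * star y) * star d - p‖ * ‖p‖ := norm_mul₃_le
      _ ≤ 1 * (1 / 2) * 1 := by gcongr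
      _ = 1 / 2 := by norm_num
  have hu : IsSelfAdjoint (w * star w) := IsSelfAdjoint.mul_star_self w
  have h1 := one_le_two_smul hu hnorm
  have hunit : IsUnit (w * star w) := by
    have := isUnit_one_sub_of_norm_lt_one (x := 1 - w * star w)
      (by rw [norm_sub_rev]; linarith)
    simpa using this
  obtain ⟨g, hg⟩ := hunit
  have hwu : IsUnit w := isUnit_of_right_inv hsr1 (r := star w * (↑g⁻¹ : A))
    (by rw [← mul_assoc, ← hg, Units.mul_inv])
  obtain ⟨W, hW⟩ := hwu
  set v : A := (↑W⁻¹ : A)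
  have hvw : v * w = 1 := by rw [← hW]; exact W.inv_mul
  have hvw' : star w * star v = 1 := by rw [← star_mul, hvw, star_one]
  have h2 : 0 ≤ (w * star w) * ((2 : ℝ) • (w * star w) - 1) :=
    Commute.mul_nonneg (mul_star_self_nonneg w) (sub_nonneg.2 h1)
      (((Commute.refl _).smul_right _).sub_right (Commute.one_right _))
  have h3 := star_right_conjugate_nonneg h2 v
  have h4 : v * ((w * star w) * ((2 : ℝ) • (w * star w) - 1)) * star v
      = (2 : ℝ) • (star w * w) - 1 := by
    have : v * ((w * star w) * ((2 : ℝ) • (w * star w) - 1)) * star v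
      = (2 : ℝ) • ((v * w) * (star w * w) * (star w * star v)) -
        (v * w) * (star w * star v) := by
      simp only [mul_sub, sub_mul, mul_smul_comm, smul_mul_assoc, mul_one, mul_assoc]
    rw [this, hvw, hvw']; simp
  rw [h4, sub_nonneg] at h3
  -- compress by p
  have h5 := star_right_conjugate_le_conjugate h3 p
  have h7 : p * ((2 : ℝ) • (star w * w)) * star p
      = (2 : ℝ) • (star y * (star d * p * d) * y) := by
    rw [hws, hw, mul_smul_comm, smul_mul_assoc, hps]
    congr 1
    simp only [mul_add, add_mul, mul_sub, sub_mul, mul_one, one_mul, mul_assoc, hy, hy', hpp,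
      hy1, hy2, hpp1]
    abel
  rw [h7, mul_one, hps, hpp] at h5
  have hp1 : p ≤ 1 := by
    have : 0 ≤ star (1 - p) * (1 - p) := star_mul_self_nonneg _
    have e : star (1 - p) * (1 - p) = 1 - p := by
      simp [hps, mul_sub, sub_mul, hpp]
    rw [e] at this
    exact sub_nonneg.1 this
  have h8 : star d * p * d ≤ algebraMap ℝ A (‖d‖ ^ 2) := by
    have := star_left_conjugate_le_conjugate hp1 d
    rw [mul_one] at this
    exact this.trans CStarAlgebra.star_mul_le_algebraMap_norm_sq
  have h9 := star_left_conjugate_le_conjugate h8 y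
  rw [Algebra.algebraMap_eq_smul_one, mul_smul_comm, smul_mul_assoc, mul_one] at h9
  have h10 : p ≤ (2 * ‖d‖ ^ 2) • (star y * y) := by
    rw [mul_smul]
    exact h5.trans (smul_le_smul_of_nonneg_left h9 zero_le_two)
  have h11 := star_right_conjugate_le_conjugate h10 y
  rw [hy, mul_smul_comm, smul_mul_assoc] at h11
  simpa only [mul_assoc] using h11

theorem gap_main {A : Type*} [CStarAlgebra A] [PartialOrder A] [StarOrderedRing A]
    (hsr1 : Dense {x : A | IsUnit x}) {p d b : A} (hp : IsProjection p)
    (hb : CuntzBelow b p) (h : ‖d * b * star d - p‖ < 1 / 2) :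
    b ≤ (2 * ‖d‖ ^ 2) • (b * b) := by
  obtain ⟨c, hc⟩ := hb
  have hps : star p = p := hp.1
  have hpp : p * p = p := hp.2
  have e : ∀ n, c n * p * star (c n) = (c n * p) * star (c n * p) := fun n => by
    rw [star_mul, hps, ← mul_assoc, mul_assoc (c n) p p, hpp]
  simp only [e] at hc
  have hlim : Filter.Tendsto
      (fun n => (2 * ‖d‖ ^ 2) • ((c n * p) * star (c n * p) * ((c n * p) * star (c n * p))))
      Filter.atTop (nhds ((2 * ‖d‖ ^ 2) • (b * b))) := (hc.mul hc).const_smul _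
  have hn : Filter.Tendsto (fun n => ‖d * ((c n * p) * star (c n * p)) * star d - p‖)
      Filter.atTop (nhds ‖d * b * star d - p‖) :=
    (((hc.const_mul d).mul_const (star d)).sub_const p).norm
  refine le_of_tendsto_of_tendsto hc hlim ?_
  filter_upwards [hn.eventually_lt_const h] with n hn
  exact gap_step hsr1 hp (by rw [mul_assoc, hpp]) hn.le

theorem spec_gap {A : Type*} [CStarAlgebra A] [PartialOrder A] [StarOrderedRing A]
    {b : A} {K : ℝ} (hb : 0 ≤ b) (h : b ≤ K • (b * b)) :
    ∀ x ∈ spectrum ℝ b, x = 0 ∨ (0 < x ∧ 1 ≤ K * x) := by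
  have hbs : IsSelfAdjoint b := .of_nonneg hb
  intro x hx
  have hx0 : 0 ≤ x := spectrum_nonneg_of_nonneg hb hx
  have h1 : 0 ≤ cfc (fun x : ℝ => K * (x * x) - x) b := by
    rw [cfc_sub .., cfc_const_mul .., cfc_mul .., cfc_id' ℝ b]
    exact sub_nonneg.2 h
  have h2 := (cfc_nonneg_iff (fun x : ℝ => K * (x * x) - x) b).1 h1 x hx
  rcases hx0.eq_or_lt with h0 | h0
  · exact Or.inl h0.symm
  · refine Or.inr ⟨h0, ?_⟩
    by_contra hlt
    push Not at hlt
    nlinarith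

/-- support projection -/
noncomputable def suppProj {A : Type*} [CStarAlgebra A] (b : A) : A :=
  cfc (fun x : ℝ => if x = 0 then 0 else 1) b

noncomputable def ramp (K : ℝ) (x : ℝ) : ℝ := min 1 (max 0 (K * x))

theorem ramp_cont (K : ℝ) : Continuous (ramp K) := by unfold ramp; fun_prop

theorem ramp_eq {K x : ℝ} (h : x = 0 ∨ (0 < x ∧ 1 ≤ K * x)) :
    ramp K x = if x = 0 then 0 else 1 := by
  unfold ramp
  rcases h with h | ⟨h, h'⟩
  · simp [h]
  · rw [if_neg h.ne', max_eq_right (by linarith), min_eq_left h']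

theorem suppProj_eq {A : Type*} [CStarAlgebra A] [PartialOrder A] [StarOrderedRing A]
    {b : A} {K : ℝ} (hb : 0 ≤ b) (h : b ≤ K • (b * b)) : suppProj b = cfc (ramp K) b :=
  cfc_congr fun x hx => (ramp_eq (spec_gap hb h x hx)).symm

theorem suppProj_isProjection {A : Type*} [CStarAlgebra A] [PartialOrder A] [StarOrderedRing A]
    {b : A} {K : ℝ} (hb : 0 ≤ b) (h : b ≤ K • (b * b)) : IsProjection (suppProj b) := by
  refine ⟨cfc_predicate _ _, ?_⟩
  have hc := (ramp_cont K).continuousOn (s := spectrum ℝ b)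
  rw [suppProj_eq hb h, IsIdempotentElem, ← cfc_mul _ _ b hc hc]
  refine cfc_congr fun x hx => ?_
  simp only [ramp_eq (spec_gap hb h x hx)]
  split_ifs <;> simp

theorem suppProj_proj {A : Type*} [CStarAlgebra A] {p : A} (hp : IsProjection p) :
    suppProj p = p := by
  have hps : IsSelfAdjoint p := hp.1
  have hpp : p * p = p := hp.2
  have h0 : cfc (fun x : ℝ => x * x - x) p = 0 := by
    rw [cfc_sub .., cfc_mul .., cfc_id' ℝ p, hpp, sub_self]
  have h1 : ∀ x ∈ spectrum ℝ p, x * x - x = 0 := by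
    intro x hx
    have : (spectrum ℝ p).EqOn (fun x : ℝ => x * x - x) (fun _ => 0) := by
      rw [← cfc_eq_cfc_iff_eqOn (ha := hps), h0, cfc_const_zero]
    exact this hx
  conv_rhs => rw [← cfc_id' ℝ p]
  refine cfc_congr fun x hx => ?_
  have := h1 x hx
  by_cases hx0 : x = 0
  · simp [hx0]
  · simp only [if_neg hx0]
    have h3 : x * (x - 1) = 0 := by linarith
    rcases mul_eq_zero.1 h3 with h | h
    · exact absurd h hx0
    · linarith

theorem homotopy_mem {A : Type*} [CStarAlgebra A] [PartialOrder A] [StarOrderedRing A]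
    {b : A} {K t : ℝ} (hb : 0 ≤ b) (h : b ≤ K • (b * b)) (ht0 : 0 ≤ t) (ht1 : t ≤ 1) :
    0 ≤ (1 - t) • b + t • suppProj b ∧ CuntzEquiv ((1 - t) • b + t • suppProj b) b := by
  have hbs : IsSelfAdjoint b := .of_nonneg hb
  have hg := spec_gap hb h
  have hrc := (ramp_cont K).continuousOn (s := spectrum ℝ b)
  set f : ℝ → ℝ := fun x => (1 - t) * x + t * ramp K x with hf
  have hfc : ContinuousOn f (spectrum ℝ b) := by
    have := ramp_cont K
    fun_prop
  have hF : (1 - t) • b + t • suppProj b = cfc f b := by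
    rw [suppProj_eq hb h, hf, cfc_add .., cfc_const_mul .., cfc_const_mul .., cfc_id' ℝ b]
  -- regularised identity, positive and equal to the identity on the nonzero spectrum
  set M : ℝ → ℝ := fun x => x + (1 - ramp K x) with hM
  have hMc : ContinuousOn M (spectrum ℝ b) := by
    have := ramp_cont K
    fun_prop
  set N : ℝ → ℝ := fun x => (1 - t) * M x + t with hN
  have hNc : ContinuousOn N (spectrum ℝ b) := by fun_prop
  have hMpos : ∀ x ∈ spectrum ℝ b, 0 < M x := by
    intro x hx
    simp only [hM, ramp_eq (hg x hx)]
    rcases hg x hx with h | ⟨h, h'⟩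
    · simp [h]
    · simp [h.ne', h]
  have hNpos : ∀ x ∈ spectrum ℝ b, 0 < N x := by
    intro x hx
    have := hMpos x hx
    simp only [hN]
    rcases ht1.eq_or_lt with h | h
    · simp [h]
    · have : 0 < (1 - t) * M x := mul_pos (by linarith) this
      linarith
  have key : ∀ x ∈ spectrum ℝ b, f x * M x = x * N x := by
    intro x hx
    simp only [hf, hN, hM, ramp_eq (hg x hx)]
    rcases hg x hx with h | ⟨h, h'⟩
    · simp [h]
    · simp only [h.ne', if_false]; ring
  have hH : ContinuousOn (fun x => Real.sqrt (N x / M x)) (spectrum ℝ b) :=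
    (hNc.div hMc fun x hx => (hMpos x hx).ne').sqrt
  have hL : ContinuousOn (fun x => Real.sqrt (M x / N x)) (spectrum ℝ b) :=
    (hMc.div hNc fun x hx => (hNpos x hx).ne').sqrt
  rw [hF]
  refine ⟨cfc_nonneg fun x hx => ?_, ?_, ?_⟩
  · have hx0 : 0 ≤ x := spectrum_nonneg_of_nonneg hb hx
    have : 0 ≤ ramp K x := by unfold ramp; positivity
    have : 0 ≤ 1 - t := by linarith
    simp only [hf]; positivity
  · apply CuntzBelow.of_eq (d := cfc (fun x => Real.sqrt (N x / M x)) b)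
    have hs : IsSelfAdjoint (cfc (fun x => Real.sqrt (N x / M x)) b) := cfc_predicate _ _
    rw [hs.star_eq]
    conv_lhs => rw [mul_assoc]; enter [2, 1]; rw [← cfc_id' ℝ b]
    have hiH : ContinuousOn (fun x => x * Real.sqrt (N x / M x)) (spectrum ℝ b) :=
      (continuousOn_id' _).mul hH
    rw [← cfc_mul _ _ b (continuousOn_id' _) hH, ← cfc_mul _ _ b hH hiH]
    refine cfc_congr fun x hx => ?_
    have h1 := hMpos x hx
    have h2 := hNpos x hx
    have h3 := Real.mul_self_sqrt (div_pos h2 h1).le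
    have h4 := key x hx
    calc _ = x * (√(N x / M x) * √(N x / M x)) := by ring
      _ = f x := by rw [h3]; field_simp; linarith
  · apply CuntzBelow.of_eq (d := cfc (fun x => Real.sqrt (M x / N x)) b)
    have hs : IsSelfAdjoint (cfc (fun x => Real.sqrt (M x / N x)) b) := cfc_predicate _ _
    have hfL : ContinuousOn (fun x => f x * Real.sqrt (M x / N x)) (spectrum ℝ b) := hfc.mul hL
    rw [hs.star_eq, mul_assoc, ← cfc_mul _ _ b hfc hL, ← cfc_mul _ _ b hL hfL]
    conv_rhs => rw [← cfc_id' ℝ b]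
    refine cfc_congr fun x hx => ?_
    have h1 := hMpos x hx
    have h2 := hNpos x hx
    have h3 := Real.mul_self_sqrt (div_pos h1 h2).le
    have h4 := key x hx
    calc _ = f x * (√(M x / N x) * √(M x / N x)) := by ring
      _ = x := by rw [h3]; field_simp; linarith

theorem suppProj_cont {A : Type*} [CStarAlgebra A] [PartialOrder A] [StarOrderedRing A]
    (hsr1 : Dense {x : A | IsUnit x}) {p : A} (hp : IsProjection p) :
    ContinuousOn (suppProj : A → A) {b | 0 ≤ b ∧ CuntzEquiv b p} := by
  intro b hb
  obtain ⟨d, hd⟩ := hb.2.2.exists_lt (ε := 1 / 2) (by norm_num)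
  have hev : ∀ᶠ x in nhdsWithin b {b | 0 ≤ b ∧ CuntzEquiv b p},
      x ≤ (2 * ‖d‖ ^ 2) • (x * x) := by
    have : ∀ᶠ x in nhds b, ‖d * x * star d - p‖ < 1 / 2 :=
      (Continuous.tendsto (f := fun x => ‖d * x * star d - p‖) (by fun_prop) b).eventually_lt_const hd
    filter_upwards [nhdsWithin_le_nhds this, self_mem_nhdsWithin] with x hx hxs
    exact gap_main hsr1 hp hxs.2.1 hx
  have heq : suppProj =ᶠ[nhdsWithin b {b | 0 ≤ b ∧ CuntzEquiv b p}] cfc (ramp (2 * ‖d‖ ^ 2)) := by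
    filter_upwards [hev, self_mem_nhdsWithin] with x hx hxs
    exact suppProj_eq hxs.1 hx
  refine ContinuousWithinAt.congr_of_eventuallyEq ?_ heq (heq.self_of_nhdsWithin hb)
  have hcont : ContinuousOn (fun x : A => cfc (ramp (2 * ‖d‖ ^ 2)) x)
      {b | 0 ≤ b ∧ CuntzEquiv b p} :=
    ContinuousOn.cfc_of_mem_nhdsSet (s := Set.univ) _ Filter.univ_mem continuousOn_id
      (fun x hx => IsSelfAdjoint.of_nonneg hx.1) (ramp_cont _).continuousOn
  exact hcont b hb

theorem stmt4 {A : Type*} [CStarAlgebra A] [PartialOrder A] [StarOrderedRing A]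
    (hsimple : ∀ I : TwoSidedIdeal A, IsClosed (I : Set A) → I = ⊥ ∨ I = ⊤)
    (hsr1 : Dense {x : A | IsUnit x})
    (a : A) (ha : 0 ≤ a)
    (hcompact : ∃ p : A, IsProjection p ∧ CuntzEquiv a p) :
    ∃ F : Set.Icc (0 : ℝ) 1 × {b : A // 0 ≤ b ∧ CuntzEquiv b a} →
        {b : A // 0 ≤ b ∧ CuntzEquiv b a},
      Continuous F ∧
      (∀ b, F (⟨0, Set.left_mem_Icc.mpr zero_le_one⟩, b) = b) ∧
      (∀ b, IsProjection ((F (⟨1, Set.right_mem_Icc.mpr zero_le_one⟩, b) : {b : A // 0 ≤ b ∧ CuntzEquiv b a}) : A)) ∧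
      (∀ t : Set.Icc (0 : ℝ) 1, ∀ p : {b : A // 0 ≤ b ∧ CuntzEquiv b a},
        IsProjection (p : A) → F (t, p) = p) := by
  obtain ⟨p, hp, hap⟩ := hcompact
  have hbp : ∀ b : A, CuntzEquiv b a → CuntzEquiv b p := fun b hb =>
    ⟨hb.1.trans' hap.1, hap.2.trans' hb.2⟩
  have hK : ∀ b : A, CuntzEquiv b a → ∃ K : ℝ, b ≤ K • (b * b) := fun b hb => by
    obtain ⟨d, hd⟩ := (hbp b hb).2.exists_lt (ε := 1 / 2) (by norm_num)
    exact ⟨_, gap_main hsr1 hp (hbp b hb).1 hd⟩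
  have hmem : ∀ x : Set.Icc (0 : ℝ) 1 × {b : A // 0 ≤ b ∧ CuntzEquiv b a},
      0 ≤ (1 - (x.1 : ℝ)) • (x.2 : A) + (x.1 : ℝ) • suppProj (x.2 : A) ∧
      CuntzEquiv ((1 - (x.1 : ℝ)) • (x.2 : A) + (x.1 : ℝ) • suppProj (x.2 : A)) a := by
    rintro ⟨⟨t, ht0, ht1⟩, ⟨b, hb, hba⟩⟩
    obtain ⟨K, hK⟩ := hK b hba
    obtain ⟨h1, h2⟩ := homotopy_mem hb hK ht0 ht1
    exact ⟨h1, h2.1.trans' hba.1, hba.2.trans' h2.2⟩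
  have hq : Continuous (fun b : {b : A // 0 ≤ b ∧ CuntzEquiv b a} => suppProj (b : A)) :=
    (suppProj_cont hsr1 hp).comp_continuous continuous_subtype_val
      (fun b => ⟨b.2.1, hbp _ b.2.2⟩)
  refine ⟨fun x => ⟨_, hmem x⟩, ?_, ?_, ?_, ?_⟩
  · refine Continuous.subtype_mk ?_ _
    have := hq.comp (continuous_snd (X := Set.Icc (0 : ℝ) 1))
    have h1 : Continuous fun x : Set.Icc (0 : ℝ) 1 × {b : A // 0 ≤ b ∧ CuntzEquiv b a} =>
      (x.1 : ℝ) := continuous_subtype_val.comp continuous_fst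
    have h2 : Continuous fun x : Set.Icc (0 : ℝ) 1 × {b : A // 0 ≤ b ∧ CuntzEquiv b a} =>
      (x.2 : A) := continuous_subtype_val.comp continuous_snd
    exact ((continuous_const.sub h1).smul h2).add (h1.smul this)
  · intro b
    apply Subtype.ext
    simp
  · intro b
    obtain ⟨K, hK⟩ := hK b b.2.2
    simpa using suppProj_isProjection b.2.1 hK
  · intro t q hq
    apply Subtype.ext
    simp only [suppProj_proj hq]
    rw [← add_smul]
    simp
end

section
/- Let A be a unital C*-algebra and let v be a positive element of A such that for some δ > 0 the spectrum of v contains no point of the open interval (0, δ). For t ∈ [0,1) define f_t : [0,∞) → ℝ by f_t(s) = s/(1−t) for 0 ≤ s < 1−t, f_t(s) = 1 for 1−t ≤ s < 1, and f_t(s) = 1 − (1−t)(1−s) for s ≥ 1; define f_1(0) = 0 and f_1(s) = 1 for s > 0 (so that each f_t, including f_1, is continuous on the spectrum of v). Then: (i) the map t ↦ f_t(v) (continuous functional calculus) from [0,1] to A is continuous; (ii) f_0(v) = v; (iii) f_1(v) is a projection in A; and (iv) f_t(v) is Cuntz equivalent to v for every t ∈ [0,1]. -/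
/-- The family of functions `f_t`, `t ∈ [0,1]`: for `t < 1`,
`f_t(s) = s/(1-t)` on `0 ≤ s < 1-t`, `f_t(s) = 1` on `1-t ≤ s < 1`, and
`f_t(s) = 1 - (1-t)(1-s)` for `s ≥ 1`; for `t = 1`, `f_1(0) = 0` and
`f_1(s) = 1` for `s > 0`. -/
noncomputable def pwf (t s : ℝ) : ℝ :=
  if t < 1 then
    (if s < 1 - t then s / (1 - t) else if s < 1 then 1 else 1 - (1 - t) * (1 - s))
  else
    (if s ≤ 0 then 0 else 1)

/-- A continuous replacement for `pwf` agreeing with it on the spectrum. -/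
noncomputable def pwg (δ t s : ℝ) : ℝ :=
  min (s / max (1 - t) δ) 1 + (1 - t) * max (s - 1) 0

theorem pwg_continuous (δ : ℝ) (hδ : 0 < δ) :
    Continuous (fun p : ℝ × ℝ => pwg δ p.1 p.2) := by
  unfold pwg
  have h : ∀ p : ℝ × ℝ, max (1 - p.1) δ ≠ 0 := fun p =>
    (lt_of_lt_of_le hδ (le_max_right _ _)).ne'
  fun_prop (disch := assumption)

theorem pwf_eq_pwg {δ t s : ℝ} (hδ : 0 < δ) (ht : t ∈ Set.Icc (0 : ℝ) 1)
    (hs : s = 0 ∨ δ ≤ s) : pwf t s = pwg δ t s := by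
  obtain ⟨h0, h1⟩ := ht
  unfold pwf pwg
  have hm : 0 < max (1 - t) δ := lt_of_lt_of_le hδ (le_max_right _ _)
  rcases hs with rfl | hs
  · by_cases ht1 : t < 1
    · have : (0 : ℝ) < 1 - t := by linarith
      simp [ht1]
    · simp [ht1]
  · have hs0 : 0 < s := lt_of_lt_of_le hδ hs
    by_cases ht1 : t < 1
    · have h2 : (0 : ℝ) < 1 - t := by linarith
      rw [if_pos ht1]
      split_ifs with h3 h4
      · have h5 : max (1 - t) δ = 1 - t := max_eq_left (by linarith)
        rw [h5, min_eq_left ((div_le_one h2).2 h3.le), max_eq_right (by linarith)]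
        simp
      · rw [min_eq_right ((one_le_div hm).2 (max_le (by linarith) hs)),
          max_eq_right (by linarith)]
        simp
      · rw [min_eq_right ((one_le_div hm).2 (max_le (by linarith) hs)),
          max_eq_left (by linarith)]
        ring
    · have : t = 1 := by linarith
      subst this
      rw [min_eq_right ((one_le_div hm).2 (max_le (by linarith) hs))]
      simp [hs0]

theorem cuntzBelow_cfc {A : Type*} [CStarAlgebra A] (v : A) (hv : IsSelfAdjoint v)
    (p q : ℝ → ℝ) (hp : ContinuousOn p (spectrum ℝ v)) (hq : ContinuousOn q (spectrum ℝ v))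
    (c : ℝ) (hc : 0 < c)
    (h : ∀ s ∈ spectrum ℝ v, (p s = 0 ∧ q s = 0) ∨ (0 ≤ p s ∧ c ≤ q s)) :
    CuntzBelow (cfc p v) (cfc q v) := by
  have hk : ContinuousOn (fun s => √(p s / max (q s) c)) (spectrum ℝ v) := by
    have h0 : ∀ s ∈ spectrum ℝ v, max (q s) c ≠ 0 := fun s _ =>
      (lt_of_lt_of_le hc (le_max_right _ _)).ne'
    exact (hp.div (ContinuousOn.sup hq continuousOn_const) h0).sqrt
  refine ⟨fun _ => cfc (fun s => √(p s / max (q s) c)) v, ?_⟩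
  have hsa : star (cfc (fun s => √(p s / max (q s) c)) v)
      = cfc (fun s => √(p s / max (q s) c)) v := cfc_predicate (R := ℝ) _ v
  beta_reduce
  rw [hsa, ← cfc_mul _ _ v hk hq, ← cfc_mul (fun x => √(p x / max (q x) c) * q x) _ v (hk.mul hq) hk]
  have : cfc (fun s => √(p s / max (q s) c) * q s * √(p s / max (q s) c)) v = cfc p v := by
    apply cfc_congr
    intro s hs
    rcases h s hs with ⟨h1, h2⟩ | ⟨h1, h2⟩
    · simp [h1]
    · have hq0 : 0 < q s := lt_of_lt_of_le hc h2
      simp only [max_eq_left h2]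
      rw [mul_right_comm, Real.mul_self_sqrt (div_nonneg h1 hq0.le)]
      field_simp
  rw [this]
  exact tendsto_const_nhds

theorem stmt6 {A : Type*} [CStarAlgebra A] [PartialOrder A] [StarOrderedRing A]
    (v : A) (hv : 0 ≤ v) (δ : ℝ) (hδ : 0 < δ)
    (hgap : ∀ s ∈ spectrum ℝ v, s ∉ Set.Ioo (0 : ℝ) δ) :
    Continuous (fun t : Set.Icc (0 : ℝ) 1 => cfc (pwf (t : ℝ)) v) ∧
    cfc (pwf 0) v = v ∧
    (IsSelfAdjoint (cfc (pwf 1) v) ∧ IsIdempotentElem (cfc (pwf 1) v)) ∧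
    (∀ t ∈ Set.Icc (0 : ℝ) 1, CuntzEquiv (cfc (pwf t) v) v) := by
  have hsa : IsSelfAdjoint v := IsSelfAdjoint.of_nonneg hv
  have hspec : ∀ s ∈ spectrum ℝ v, s = 0 ∨ δ ≤ s := by
    intro s hs
    have h0 : 0 ≤ s := spectrum_nonneg_of_nonneg hv hs
    rcases h0.eq_or_lt with h | h
    · exact Or.inl h.symm
    · right
      by_contra! h'
      exact hgap s hs ⟨h, h'⟩
  have heq : ∀ t ∈ Set.Icc (0 : ℝ) 1, Set.EqOn (pwf t) (pwg δ t) (spectrum ℝ v) :=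
    fun t ht s hs => pwf_eq_pwg hδ ht (hspec s hs)
  have hcont : ∀ t ∈ Set.Icc (0 : ℝ) 1, ContinuousOn (pwf t) (spectrum ℝ v) := by
    intro t ht
    refine ContinuousOn.congr ?_ (heq t ht)
    exact ((pwg_continuous δ hδ).comp (Continuous.prodMk_right t)).continuousOn
  refine ⟨?_, ?_, ⟨cfc_predicate (R := ℝ) _ v, ?_⟩, ?_⟩
  · have : (fun t : Set.Icc (0 : ℝ) 1 => cfc (pwf (t : ℝ)) v)
        = fun t : Set.Icc (0 : ℝ) 1 => cfc (pwg δ (t : ℝ)) v := by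
      funext t
      exact cfc_congr (heq t t.2)
    rw [this]
    have hc : Continuous (fun t : ℝ => cfc (pwg δ t) v) := by
      rw [continuous_iff_continuousAt]
      intro t
      apply continuousAt_cfc_fun
      · rw [tendstoUniformlyOn_iff_tendstoUniformly_comp_coe]
        haveI : CompactSpace (spectrum ℝ v) := isCompact_iff_compactSpace.1
          (ContinuousFunctionalCalculus.isCompact_spectrum (R := ℝ) v)
        exact Continuous.tendstoUniformly (fun (t : ℝ) (s : spectrum ℝ v) => pwg δ t s)
          ((pwg_continuous δ hδ).comp
            (continuous_fst.prodMk (continuous_subtype_val.comp continuous_snd))) t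
      · exact Filter.Eventually.of_forall fun t =>
          ((pwg_continuous δ hδ).comp (Continuous.prodMk_right t)).continuousOn
    exact hc.comp continuous_subtype_val
  · conv_rhs => rw [← cfc_id ℝ v]
    apply cfc_congr
    intro s hs
    simp only [pwf, id]
    split_ifs <;> norm_num at * <;> linarith
  · have h1 := hcont 1 (by simp)
    rw [IsIdempotentElem, ← cfc_mul _ _ v h1 h1]
    apply cfc_congr
    intro s hs
    simp only [pwf]
    split_ifs <;> norm_num
  · intro t ht
    have hm : 0 < max (1 - t) δ := lt_of_lt_of_le hδ (le_max_right _ _)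
    have h1 := hcont t ht
    have hc : 0 < δ / max (1 - t) δ := by positivity
    have key : ∀ s ∈ spectrum ℝ v, (s = 0 ∧ pwf t s = 0) ∨
        (δ ≤ s ∧ δ / max (1 - t) δ ≤ pwf t s) := by
      intro s hs
      rcases hspec s hs with h | h
      · left
        refine ⟨h, ?_⟩
        rw [heq t ht hs, h]
        simp [pwg]
      · right
        refine ⟨h, ?_⟩
        rw [heq t ht hs]
        unfold pwg
        have h2 : 0 ≤ (1 - t) * max (s - 1) 0 :=
          mul_nonneg (by linarith [ht.2]) (le_max_right _ _)
        have h3 : δ / max (1 - t) δ ≤ min (s / max (1 - t) δ) 1 :=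
          le_min (by gcongr) ((div_le_one hm).2 (le_max_right _ _))
        linarith
    have a := cuntzBelow_cfc v hsa (pwf t) id h1 continuousOn_id δ hδ (by
      intro s hs
      rcases key s hs with h | h
      · exact Or.inl ⟨h.2, h.1⟩
      · exact Or.inr ⟨by linarith [h.2], h.1⟩)
    have b := cuntzBelow_cfc v hsa id (pwf t) continuousOn_id h1 _ hc (by
      intro s hs
      rcases key s hs with h | h
      · exact Or.inl ⟨h.1, h.2⟩
      · exact Or.inr ⟨by simp only [id]; linarith [h.1], h.2⟩)
    rw [cfc_id ℝ v] at a b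
    exact ⟨a, b⟩
end
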